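/- Let P be a simple polygon and W a witness set of P; assume Vis(u) equals the closure of its interior for every u ∈ W. Let w ∈ W, let NV₁ and NV₂ be connected components of NVis(W), and let e₁ and e₂ be windows of Vis(w) such that NV₁ is attached to Vis(w) along e₁ and NV₂ is attached to Vis(w) along e₂. Then NV₁ = NV₂ if and only if e₁ = e₂. -/

import Mathlib

open Set

noncomputable section

abbrev Plane := EuclideanSpace ℝ (Fin 2)

/-- A simple polygon, given by a cyclic sequence of at least three distinct vertices
whose closed polygonal boundary curve is a Jordan polygon: two edges intersect exactly
when they are consecutive, and then only in their one shared endpoint. -/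
structure SimplePolygon where
  n : ℕ
  three_le : 3 ≤ n
  vertex : ℕ → Plane
  periodic : ∀ i, vertex (i + n) = vertex i
  inj : ∀ i < n, ∀ j < n, vertex i = vertex j → i = j
  jordan : ∀ i < n, ∀ j < n, i ≠ j →
    segment ℝ (vertex i) (vertex (i + 1)) ∩ segment ℝ (vertex j) (vertex (j + 1)) =
      if j = (i + 1) % n then {vertex (i + 1)}
      else if i = (j + 1) % n then {vertex (j + 1)}
      else ∅

namespace SimplePolygon

/-- The boundary curve of the polygon: the union of its edges. -/
def boundary (P : SimplePolygon) : Set Plane :=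
  ⋃ i ∈ Finset.range P.n, segment ℝ (P.vertex i) (P.vertex (i + 1))

/-- The polygon as a region: the boundary together with all bounded connected
components of the complement of the boundary. -/
def region (P : SimplePolygon) : Set Plane :=
  P.boundary ∪ {x | x ∉ P.boundary ∧
    Bornology.IsBounded (connectedComponentIn P.boundaryᶜ x)}

/-- Visibility region of a point `p`: all points `q` of the polygon such that the
closed segment `[p,q]` is contained in the polygon. -/
def Vis (P : SimplePolygon) (p : Plane) : Set Plane :=
  {q | q ∈ P.region ∧ segment ℝ p q ⊆ P.region}

/-- Visibility region of a set. -/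
def VisSet (P : SimplePolygon) (S : Set Plane) : Set Plane :=
  ⋃ p ∈ S, P.Vis p

/-- Two points of the polygon are visible to each other if the segment joining them
lies in the polygon. -/
def Visible (P : SimplePolygon) (p q : Plane) : Prop :=
  p ∈ P.region ∧ q ∈ P.region ∧ segment ℝ p q ⊆ P.region

/-- A witness set: a finite set of points of the polygon with pairwise disjoint
visibility regions. -/
def IsWitnessSet (P : SimplePolygon) (W : Set Plane) : Prop :=
  W.Finite ∧ W ⊆ P.region ∧
    ∀ x ∈ W, ∀ y ∈ W, x ≠ y → P.Vis x ∩ P.Vis y = ∅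

/-- The non-visible region of a witness set. -/
def NVis (P : SimplePolygon) (W : Set Plane) : Set Plane :=
  P.region \ ⋃ w ∈ W, P.Vis w

/-- `Vis p` is regular (has no arms) if it equals the closure of its interior. -/
def VisRegular (P : SimplePolygon) (p : Plane) : Prop :=
  P.Vis p = closure (interior (P.Vis p))

/-- A window of `Vis p`: a non-degenerate closed segment contained in the frontier of
`Vis p` whose intersection with the frontier of the polygon is exactly its two
endpoints, maximal with these properties. -/
def IsWindow (P : SimplePolygon) (p : Plane) (e : Set Plane) : Prop :=
  ∃ a b : Plane, a ≠ b ∧ e = segment ℝ a b ∧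
    e ⊆ frontier (P.Vis p) ∧
    e ∩ frontier P.region = {a, b} ∧
    ∀ a' b' : Plane, a' ≠ b' →
      segment ℝ a' b' ⊆ frontier (P.Vis p) →
      segment ℝ a' b' ∩ frontier P.region = {a', b'} →
      e ⊆ segment ℝ a' b' → e = segment ℝ a' b'

/-- `γ` is (the image of) a neighbor witness path between `w` and `w'`. -/
def IsNWPath (P : SimplePolygon) (W : Set Plane) (w w' : Plane) (γ : Set Plane) : Prop :=
  ∃ f : Path w w', γ = Set.range f ∧ γ ⊆ P.Vis w ∪ P.NVis W ∪ P.Vis w'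

/-- Adjacency in the neighbor witness graph `GCon(W)`. -/
def GConAdj (P : SimplePolygon) (W : Set Plane) (w w' : Plane) : Prop :=
  w ∈ W ∧ w' ∈ W ∧ w ≠ w' ∧ ∃ γ : Set Plane, P.IsNWPath W w w' γ

/-- A connected component `NV` of `NVis W` is attached to `Vis w` if the closure of
`NV` intersects `Vis w`. -/
def Attached (P : SimplePolygon) (NV : Set Plane) (w : Plane) : Prop :=
  (closure NV ∩ P.Vis w).Nonempty

/-- `w` is a simplicial vertex of `GCon(W)`: its neighbors are pairwise adjacent. -/
def Simplicial (P : SimplePolygon) (W : Set Plane) (w : Plane) : Prop :=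
  ∀ u v : Plane, P.GConAdj W w u → P.GConAdj W w v → u ≠ v → P.GConAdj W u v

end SimplePolygon

/-- `NV` is a connected component of `S`. -/
def IsCompOf (NV S : Set Plane) : Prop :=
  ∃ x ∈ S, NV = connectedComponentIn S x

open Topology

/-- A set is locally conic if around every point it agrees with a cone with that apex. -/
def LocallyConic (K : Set Plane) : Prop :=
  ∀ z, ∃ r > 0, ∀ y, dist y z < r → ∀ t : ℝ, 0 < t → t ≤ 1 → (z + t • (y - z) ∈ K ↔ y ∈ K)

/-- The points `q` such that the closed segment from `w` to `q` is contained in `K`. -/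
def visibleFrom (K : Set Plane) (w : Plane) : Set Plane := {q | segment ℝ w q ⊆ K}

lemma mem_segment_iff_exists_add_smul {w q y : Plane} :
    y ∈ segment ℝ w q ↔ ∃ t : ℝ, 0 ≤ t ∧ t ≤ 1 ∧ y = w + t • (q - w) := by
  rw [segment_eq_image']
  constructor
  · rintro ⟨t, ⟨h0, h1⟩, rfl⟩
    exact ⟨t, h0, h1, rfl⟩
  · rintro ⟨t, h0, h1, rfl⟩
    exact ⟨t, ⟨h0, h1⟩, rfl⟩

lemma mem_visibleFrom_iff {K : Set Plane} {w q : Plane} :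
    q ∈ visibleFrom K w ↔ ∀ t : ℝ, 0 ≤ t → t ≤ 1 → w + t • (q - w) ∈ K := by
  constructor
  · intro h t h0 h1
    exact h (mem_segment_iff_exists_add_smul.2 ⟨t, h0, h1, rfl⟩)
  · intro h y hy
    obtain ⟨t, h0, h1, rfl⟩ := mem_segment_iff_exists_add_smul.1 hy
    exact h t h0 h1

lemma visibleFrom_subset {K : Set Plane} {w : Plane} : visibleFrom K w ⊆ K :=
  fun q hq => hq (right_mem_segment ℝ w q)

lemma isClosed_visibleFrom {K : Set Plane} (hK : IsClosed K) (w : Plane) :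
    IsClosed (visibleFrom K w) := by
  have : visibleFrom K w = ⋂ t ∈ Icc (0 : ℝ) 1, (fun q => w + t • (q - w)) ⁻¹' K := by
    ext q
    simp only [mem_visibleFrom_iff, mem_iInter, mem_preimage, mem_Icc, and_imp]
  rw [this]
  exact isClosed_biInter fun t _ => hK.preimage (by fun_prop)

lemma dist_add_smul_sub_lt {y z : Plane} {r t : ℝ} (h : dist y z < r) (h0 : 0 < t) (h1 : t ≤ 1) :
    dist (z + t • (y - z)) z < r := by
  rw [dist_eq_norm] at h ⊢
  rw [add_sub_cancel_left, norm_smul, Real.norm_of_nonneg h0.le]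
  nlinarith [norm_nonneg (y - z)]

lemma locallyConic_empty : LocallyConic ∅ :=
  fun _ => ⟨1, one_pos, fun _ _ _ _ _ => Iff.rfl⟩

lemma LocallyConic.union {A B : Set Plane} (hA : LocallyConic A) (hB : LocallyConic B) :
    LocallyConic (A ∪ B) := by
  intro z
  obtain ⟨r, hr, h⟩ := hA z
  obtain ⟨s, hs, h'⟩ := hB z
  refine ⟨min r s, lt_min hr hs, fun y hy t h0 h1 => ?_⟩
  exact or_congr (h y (hy.trans_le (min_le_left _ _)) t h0 h1)
    (h' y (hy.trans_le (min_le_right _ _)) t h0 h1)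

lemma locallyConic_biUnion {ι : Type*} (s : Finset ι) (A : ι → Set Plane)
    (h : ∀ i ∈ s, LocallyConic (A i)) : LocallyConic (⋃ i ∈ s, A i) := by
  classical
  induction s using Finset.induction_on with
  | empty => simpa using locallyConic_empty
  | insert i s _ ih =>
    rw [Finset.set_biUnion_insert]
    exact (h i (Finset.mem_insert_self i s)).union
      (ih fun j hj => h j (Finset.mem_insert_of_mem hj))

lemma isClosed_segment (p q : Plane) : IsClosed (segment ℝ p q) := by
  rw [segment_eq_image']
  exact (isCompact_Icc.image (by fun_prop)).isClosed

lemma locallyConic_segment (p q : Plane) : LocallyConic (segment ℝ p q) := by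
  intro z
  by_cases hz : z ∈ segment ℝ p q
  · obtain ⟨s, s0, s1, rfl⟩ := mem_segment_iff_exists_add_smul.1 hz
    by_cases hpq : p = q
    · subst hpq
      refine ⟨1, one_pos, fun y _ t t0 _ => ?_⟩
      simp only [sub_self, smul_zero, add_zero, segment_same, mem_singleton_iff]
      rw [add_eq_left, smul_eq_zero, sub_eq_zero]
      exact ⟨fun h => h.resolve_left t0.ne', Or.inr⟩
    have hd : 0 < ‖q - p‖ := norm_pos_iff.2 (sub_ne_zero.2 (Ne.symm hpq))
    set c₁ : ℝ := if s = 1 then 1 else 1 - s with hc₁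
    set c₂ : ℝ := if s = 0 then 1 else s with hc₂
    have h₁ : 0 < c₁ := by
      rw [hc₁]; split_ifs with h
      · exact one_pos
      · exact sub_pos.2 (lt_of_le_of_ne s1 h)
    have h₂ : 0 < c₂ := by
      rw [hc₂]; split_ifs with h
      · exact one_pos
      · exact lt_of_le_of_ne s0 (Ne.symm h)
    refine ⟨min c₁ c₂ * ‖q - p‖, mul_pos (lt_min h₁ h₂) hd, fun y hy t t0 t1 => ⟨fun h => ?_,
      fun h => ?_⟩⟩
    · obtain ⟨s', s0', s1', he⟩ := mem_segment_iff_exists_add_smul.1 h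
      have hy' : y = p + (s + (s' - s) / t) • (q - p) := by
        have : t • (y - (p + s • (q - p))) = (s' - s) • (q - p) := by
          rw [sub_smul, ← sub_eq_zero]
          rw [← sub_eq_zero] at he
          rw [← he]
          module
        have h2 : y - (p + s • (q - p)) = ((s' - s) / t) • (q - p) := by
          rw [div_eq_inv_mul, mul_smul, ← this, smul_smul, inv_mul_cancel₀ t0.ne', one_smul]
        rw [add_smul, ← h2]
        module
      rw [hy', dist_eq_norm] at hy
      have e1 : p + (s + (s' - s) / t) • (q - p) - (p + s • (q - p)) =
          ((s' - s) / t) • (q - p) := by module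
      rw [e1, norm_smul, mul_lt_mul_iff_left₀ hd, Real.norm_eq_abs, abs_lt, lt_min_iff] at hy
      have hneg := hy.1
      have hpos := hy.2.1
      have hc : -c₂ < (s' - s) / t :=
        lt_of_le_of_lt (neg_le_neg (min_le_right _ _)) hneg
      refine mem_segment_iff_exists_add_smul.2 ⟨_, ?_, ?_, hy'⟩
      · by_cases hs : s = 0
        · have : 0 ≤ (s' - s) / t := div_nonneg (by linarith) t0.le
          linarith
        · rw [hc₂, if_neg hs] at hc
          linarith
      · by_cases hs : s = 1
        · have : (s' - s) / t ≤ 0 := div_nonpos_of_nonpos_of_nonneg (by linarith) t0.le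
          linarith
        · rw [hc₁, if_neg hs] at hpos
          linarith
    · have := (convex_segment (𝕜 := ℝ) p q).add_smul_sub_mem hz h ⟨t0.le, t1⟩
      exact this
  · obtain ⟨r, hr, h⟩ := Metric.isOpen_iff.1 (isClosed_segment p q).isOpen_compl z hz
    refine ⟨r, hr, fun y hy t t0 t1 => ?_⟩
    exact iff_of_false (h (Metric.mem_ball.2 (dist_add_smul_sub_lt hy t0 t1)))
      (h (Metric.mem_ball.2 hy))

lemma isPreconnected_compl_closedBall (ρ : ℝ) (hρ : 0 ≤ ρ) :
    IsPreconnected (Metric.closedBall (0 : Plane) ρ)ᶜ := by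
  have hrank : 1 < Module.rank ℝ Plane := by
    rw [← Module.finrank_eq_rank, finrank_euclideanSpace_fin]
    norm_num
  have hc := (isConnected_compl_singleton_of_one_lt_rank hrank (0 : Plane)).isPreconnected
  have himage : (Metric.closedBall (0 : Plane) ρ)ᶜ =
      (fun x : Plane => (1 + ρ / ‖x‖) • x) '' {0}ᶜ := by
    ext y
    simp only [mem_compl_iff, Metric.mem_closedBall, dist_zero_right, not_le, mem_image,
      mem_singleton_iff]
    constructor
    · intro hy
      have hy0 : 0 < ‖y‖ := hρ.trans_lt hy
      have hf : 0 < 1 - ρ / ‖y‖ := by rw [sub_pos, div_lt_one hy0]; exact hy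
      refine ⟨(1 - ρ / ‖y‖) • y, smul_ne_zero hf.ne' (norm_pos_iff.1 hy0), ?_⟩
      rw [norm_smul, Real.norm_of_nonneg hf.le, smul_smul]
      have hf' : ‖y‖ - ρ ≠ 0 := by linarith
      have : (1 + ρ / ((1 - ρ / ‖y‖) * ‖y‖)) * (1 - ρ / ‖y‖) = 1 := by
        have : (1 - ρ / ‖y‖) * ‖y‖ = ‖y‖ - ρ := by field_simp
        rw [this]
        field_simp
        ring
      rw [this, one_smul]
    · rintro ⟨x, hx, rfl⟩
      have hx0 : 0 < ‖x‖ := norm_pos_iff.2 hx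
      rw [norm_smul, Real.norm_of_nonneg (by positivity), add_mul, div_mul_cancel₀ _ hx0.ne']
      linarith
  rw [himage]
  refine hc.image _ (ContinuousOn.smul (continuousOn_const.add
    (continuousOn_const.div continuous_norm.continuousOn fun x hx => ?_)) continuousOn_id)
  exact norm_ne_zero_iff.2 hx

namespace SimplePolygon

variable (P : SimplePolygon)

lemma isCompact_boundary : IsCompact P.boundary :=
  (Finset.range P.n).isCompact_biUnion fun i _ => by
    rw [segment_eq_image']
    exact isCompact_Icc.image (by fun_prop)

lemma locallyConic_boundary : LocallyConic P.boundary :=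
  locallyConic_biUnion _ _ fun _ _ => locallyConic_segment _ _

lemma mem_compl_region_iff {x : Plane} : x ∈ P.regionᶜ ↔
    x ∉ P.boundary ∧ ¬ Bornology.IsBounded (connectedComponentIn P.boundaryᶜ x) := by
  simp only [region, mem_compl_iff, mem_union, mem_ofPred_eq]
  tauto

lemma isClosed_region : IsClosed P.region := by
  rw [← isOpen_compl_iff, isOpen_iff_mem_nhds]
  intro x hx
  obtain ⟨hxB, hxC⟩ := P.mem_compl_region_iff.1 hx
  have ho : IsOpen (connectedComponentIn P.boundaryᶜ x) :=
    P.isCompact_boundary.isClosed.isOpen_compl.connectedComponentIn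
  filter_upwards [ho.mem_nhds (mem_connectedComponentIn hxB)] with y hy
  refine P.mem_compl_region_iff.2 ⟨connectedComponentIn_subset _ _ hy, ?_⟩
  rwa [← connectedComponentIn_eq hy]

lemma locallyConic_region : LocallyConic P.region := by
  intro z
  obtain ⟨r, hr, h⟩ := P.locallyConic_boundary z
  refine ⟨r, hr, fun y hy t t0 t1 => ?_⟩
  have hB := h y hy t t0 t1
  by_cases hyB : y ∈ P.boundary
  · exact iff_of_true (Or.inl (hB.2 hyB)) (Or.inl hyB)
  have hseg : segment ℝ y (z + t • (y - z)) ⊆ P.boundaryᶜ := by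
    intro x hx
    obtain ⟨s, s0, s1, rfl⟩ := mem_segment_iff_exists_add_smul.1 hx
    have e : y + s • (z + t • (y - z) - y) = z + (1 - s + s * t) • (y - z) := by module
    rw [e, mem_compl_iff, h y hy _ (by nlinarith) (by nlinarith)]
    exact hyB
  have hpre : IsPreconnected (segment ℝ y (z + t • (y - z))) :=
    (convex_segment (𝕜 := ℝ) _ _).isPreconnected
  have hcomp := connectedComponentIn_eq
    (hpre.subset_connectedComponentIn (left_mem_segment ℝ _ _) hseg (right_mem_segment ℝ _ _))
  simp only [region, mem_union, mem_ofPred_eq, hB, hcomp]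

lemma isPreconnected_compl_region : IsPreconnected P.regionᶜ := by
  obtain ⟨ρ, hρ⟩ := P.isCompact_boundary.isBounded.subset_closedBall (0 : Plane)
  set F := (Metric.closedBall (0 : Plane) (max ρ 0))ᶜ with hF
  have hFB : F ⊆ P.boundaryᶜ := by
    refine compl_subset_compl.2 (hρ.trans (Metric.closedBall_subset_closedBall (le_max_left _ _)))
  have hFc : IsPreconnected F := isPreconnected_compl_closedBall _ (le_max_right _ _)
  have hmeet : ∀ x ∈ P.regionᶜ, ∃ y ∈ F, y ∈ connectedComponentIn P.boundaryᶜ x := by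
    intro x hx
    by_contra! hcon
    refine (P.mem_compl_region_iff.1 hx).2
      ((Metric.isBounded_closedBall (x := 0) (r := max ρ 0)).subset fun y hy => ?_)
    by_contra hy'
    exact hcon y hy' hy
  have hsub : ∀ x ∈ P.regionᶜ, connectedComponentIn P.boundaryᶜ x ⊆ P.regionᶜ := by
    intro x hx y hy
    refine P.mem_compl_region_iff.2 ⟨connectedComponentIn_subset _ _ hy, ?_⟩
    rw [← connectedComponentIn_eq hy]
    exact (P.mem_compl_region_iff.1 hx).2
  rcases P.regionᶜ.eq_empty_or_nonempty with he | ⟨x, hx⟩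
  · rw [he]; exact isPreconnected_empty
  obtain ⟨p, hpF, hp⟩ := hmeet x hx
  refine isPreconnected_of_forall x fun y hy => ?_
  refine ⟨_, hsub x hx, mem_connectedComponentIn (P.mem_compl_region_iff.1 hx).1, ?_,
    isPreconnected_connectedComponentIn⟩
  obtain ⟨q, hqF, hq⟩ := hmeet y hy
  have hpq : q ∈ connectedComponentIn P.boundaryᶜ x := by
    rw [connectedComponentIn_eq hp]
    exact hFc.subset_connectedComponentIn hpF hFB hqF
  rw [connectedComponentIn_eq hpq, ← connectedComponentIn_eq hq]
  exact mem_connectedComponentIn (P.mem_compl_region_iff.1 hy).1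

lemma vis_eq_visibleFrom (p : Plane) : P.Vis p = visibleFrom P.region p := by
  ext q
  exact ⟨fun h => h.2, fun h => ⟨visibleFrom_subset h, h⟩⟩

end SimplePolygon

/-- The identification of the plane with the complex numbers. -/
def toComplex (z : Plane) : ℂ := ⟨z 0, z 1⟩

@[fun_prop]
lemma continuous_toComplex : Continuous toComplex := by
  have : toComplex = fun z : Plane => ((z 0 : ℝ) : ℂ) + ((z 1 : ℝ) : ℂ) * Complex.I := by
    funext z
    apply Complex.ext <;> simp [toComplex]
  rw [this]
  fun_prop

lemma toComplex_injective : Function.Injective toComplex := by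
  intro x y h
  have h0 := congrArg Complex.re h
  have h1 := congrArg Complex.im h
  ext i
  fin_cases i
  · exact h0
  · exact h1

lemma toComplex_sub_ne_zero {x y : Plane} (h : x ≠ y) : toComplex x - toComplex y ≠ 0 :=
  sub_ne_zero.2 (toComplex_injective.ne h)

/-- The quotient of the two displacements from `a` and from `b`, as a complex number. -/
def ratio (a b z : Plane) : ℂ := (toComplex z - toComplex b) / (toComplex z - toComplex a)

lemma ratio_mul_ratio {a b c z : Plane} (hb : z ≠ b) :
    ratio b c z * ratio a b z = ratio a c z := by
  have := toComplex_sub_ne_zero hb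
  rw [ratio, ratio, ratio]
  field_simp

lemma continuousOn_ratio (a b : Plane) : ContinuousOn (ratio a b) {a}ᶜ :=
  ContinuousOn.div (by fun_prop) (by fun_prop) fun _ h => toComplex_sub_ne_zero h

/-- The cross product of two vectors of the plane. -/
def cross (u v : Plane) : ℝ := u 0 * v 1 - u 1 * v 0

@[fun_prop]
lemma Continuous.cross {X : Type*} [TopologicalSpace X] {f g : X → Plane} (hf : Continuous f)
    (hg : Continuous g) : Continuous fun x => cross (f x) (g x) := by
  unfold _root_.cross
  fun_prop

lemma im_ratio (a b z : Plane) : (ratio a b z).im =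
    cross (b - a) (z - a) / Complex.normSq (toComplex z - toComplex a) := by
  rw [ratio, Complex.div_im, cross]
  simp only [toComplex, Complex.sub_im, Complex.sub_re, PiLp.sub_apply]
  ring

lemma im_ratio_pos {a b z : Plane} (h : 0 < cross (b - a) (z - a)) : 0 < (ratio a b z).im := by
  have hz : z ≠ a := by
    rintro rfl
    simp [cross] at h
  rw [im_ratio]
  exact div_pos h (Complex.normSq_pos.2 (toComplex_sub_ne_zero hz))

lemma im_ratio_neg {a b z : Plane} (h : cross (b - a) (z - a) < 0) : (ratio a b z).im < 0 := by
  have hz : z ≠ a := by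
    rintro rfl
    simp [cross] at h
  rw [im_ratio]
  exact div_neg_of_neg_of_pos h (Complex.normSq_pos.2 (toComplex_sub_ne_zero hz))

lemma ratio_mem_slitPlane {a b z : Plane} (hz : z ∉ segment ℝ a b) :
    ratio a b z ∈ Complex.slitPlane := by
  have hza : z ≠ a := fun h => hz (h ▸ left_mem_segment ℝ a b)
  have hne := toComplex_sub_ne_zero hza
  by_contra hcon
  rw [Complex.mem_slitPlane_iff, not_or, not_lt, not_not] at hcon
  obtain ⟨hre, him⟩ := hcon
  set ρ := -(ratio a b z).re with hρ
  have hρ0 : 0 ≤ ρ := neg_nonneg.2 hre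
  have hr : ratio a b z = ((-ρ : ℝ) : ℂ) := by
    apply Complex.ext <;> simp [hρ, him]
  have he : toComplex z - toComplex b = ((-ρ : ℝ) : ℂ) * (toComplex z - toComplex a) := by
    rw [← hr, ratio, div_mul_cancel₀ _ hne]
  have h0 := congrArg Complex.re he
  have h1 := congrArg Complex.im he
  rw [Complex.re_ofReal_mul] at h0
  rw [Complex.im_ofReal_mul] at h1
  simp only [toComplex, Complex.sub_re, Complex.sub_im] at h0 h1
  refine hz (mem_segment_iff_exists_add_smul.2 ⟨1 / (1 + ρ), by positivity, ?_, ?_⟩)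
  · rw [div_le_one (by positivity)]; linarith
  · ext i
    fin_cases i
    · simp only [Fin.zero_eta, PiLp.add_apply, PiLp.smul_apply, PiLp.sub_apply, smul_eq_mul]
      field_simp
      linarith
    · simp only [Fin.mk_one, PiLp.add_apply, PiLp.smul_apply, PiLp.sub_apply, smul_eq_mul]
      field_simp
      linarith

lemma ratio_re_neg_of_mem_openSegment {a b z : Plane} (hab : a ≠ b)
    (hz : z ∈ openSegment ℝ a b) : (ratio a b z).re < 0 := by
  obtain ⟨s, t, hs, ht, hst, rfl⟩ := hz
  have hne := toComplex_sub_ne_zero hab.symm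
  have hr : ratio a b (s • a + t • b) = ((-(s / t) : ℝ) : ℂ) := by
    have h1 : toComplex (s • a + t • b) - toComplex b =
        ((-s : ℝ) : ℂ) * (toComplex b - toComplex a) := by
      obtain rfl : t = 1 - s := by linarith
      apply Complex.ext <;> simp [toComplex] <;> ring
    have h2 : toComplex (s • a + t • b) - toComplex a =
        (t : ℂ) * (toComplex b - toComplex a) := by
      obtain rfl : s = 1 - t := by linarith
      apply Complex.ext <;> simp [toComplex] <;> ring
    have ht' : (t : ℂ) ≠ 0 := by exact_mod_cast ht.ne'
    rw [ratio, h1, h2, mul_div_mul_right _ _ hne]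
    push_cast
    ring
  rw [hr, Complex.ofReal_re, neg_lt_zero]
  positivity

lemma continuousOn_log_ratio (a b : Plane) :
    ContinuousOn (fun z => Complex.log (ratio a b z)) (segment ℝ a b)ᶜ := by
  refine ContinuousOn.clog ((continuousOn_ratio a b).mono fun z hz => ?_)
    fun z hz => ratio_mem_slitPlane hz
  rintro rfl
  exact hz (left_mem_segment ℝ _ _)

lemma exp_log_ratio {a b z : Plane} (hz : z ∉ segment ℝ a b) :
    Complex.exp (Complex.log (ratio a b z)) = ratio a b z :=
  Complex.exp_log (Complex.slitPlane_ne_zero (ratio_mem_slitPlane hz))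

lemma exists_log_ratio_of_isPreconnected {K : Set Plane} (hK : IsClosed K)
    (hc : IsPreconnected Kᶜ) {a b : Plane} (ha : a ∉ K) (hb : b ∉ K) :
    ∃ L : Plane → ℂ, ContinuousOn L K ∧ ∀ z ∈ K, Complex.exp (L z) = ratio a b z := by
  have hne : ∀ {c z : Plane}, c ∈ Kᶜ → z ∈ K → z ≠ c := fun hc hz h => hc (h ▸ hz)
  refine hc.induction₂ (fun a b => ∃ L : Plane → ℂ, ContinuousOn L K ∧
    ∀ z ∈ K, Complex.exp (L z) = ratio a b z) ?_ ?_ ?_ ha hb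
  · intro x hx
    obtain ⟨r, hr, h⟩ := Metric.isOpen_iff.1 hK.isOpen_compl x hx
    filter_upwards [mem_nhdsWithin_of_mem_nhds (Metric.ball_mem_nhds x hr)] with y hy
    have hseg : segment ℝ x y ⊆ Kᶜ :=
      ((convex_ball x r).segment_subset (Metric.mem_ball_self hr) hy).trans h
    have hz : ∀ z ∈ K, z ∉ segment ℝ x y := fun z hz hz' => hseg hz' hz
    exact ⟨_, (continuousOn_log_ratio x y).mono hz, fun z hzK => exp_log_ratio (hz z hzK)⟩
  · rintro x y z - hy - ⟨L, hL, hL'⟩ ⟨M, hM, hM'⟩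
    refine ⟨fun p => M p + L p, hM.add hL, fun p hp => ?_⟩
    rw [Complex.exp_add, hL' p hp, hM' p hp, ratio_mul_ratio (hne hy hp)]
  · rintro x y hx hy ⟨L, hL, hL'⟩
    refine ⟨fun p => -L p, hL.neg, fun p hp => ?_⟩
    rw [Complex.exp_neg, hL' p hp, ratio, ratio, inv_div]

lemma LocallyConic.exists_segment_inter_eq {K : Set Plane} (h : LocallyConic K) {a : Plane}
    (ha : a ∈ frontier K) : ∃ a' ∉ K, ∀ z ∈ segment ℝ a a', z ∈ K → z = a := by
  obtain ⟨r, hr, h⟩ := h a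
  rw [frontier_eq_closure_inter_closure] at ha
  obtain ⟨a', ha', hd⟩ := Metric.mem_closure_iff.1 ha.2 r hr
  refine ⟨a', ha', fun z hz hzK => ?_⟩
  obtain ⟨t, t0, t1, rfl⟩ := mem_segment_iff_exists_add_smul.1 hz
  rcases t0.eq_or_lt with rfl | t0
  · simp
  · exact absurd ((h a' (by rwa [dist_comm]) t t0 t1).1 hzK) ha'

lemma exists_log_ratio_of_mem_frontier {K : Set Plane} (hK : IsClosed K) (hlc : LocallyConic K)
    (hc : IsPreconnected Kᶜ) {a b : Plane} (ha : a ∈ frontier K) (hb : b ∈ frontier K) :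
    ∃ L : Plane → ℂ, ContinuousOn L (K \ {a, b}) ∧
      ∀ z ∈ K \ {a, b}, Complex.exp (L z) = ratio a b z := by
  obtain ⟨a', ha', hsa⟩ := hlc.exists_segment_inter_eq ha
  obtain ⟨b', hb', hsb⟩ := hlc.exists_segment_inter_eq hb
  obtain ⟨L, hL, hL'⟩ := exists_log_ratio_of_isPreconnected hK hc ha' hb'
  have hza : ∀ z ∈ K \ {a, b}, z ∉ segment ℝ a a' :=
    fun z hz h => hz.2 (Or.inl (hsa z h hz.1))
  have hzb : ∀ z ∈ K \ {a, b}, z ∉ segment ℝ b' b := fun z hz h =>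
    hz.2 (Or.inr (hsb z (segment_symm ℝ b b' ▸ h) hz.1))
  refine ⟨fun z => Complex.log (ratio b' b z) + (L z + Complex.log (ratio a a' z)),
    ((continuousOn_log_ratio b' b).mono hzb).add ((hL.mono sdiff_subset).add
      ((continuousOn_log_ratio a a').mono hza)), fun z hz => ?_⟩
  have hna : z ≠ a' := fun h => ha' (h ▸ hz.1)
  have hnb : z ≠ b' := fun h => hb' (h ▸ hz.1)
  rw [Complex.exp_add, Complex.exp_add, exp_log_ratio (hza z hz), exp_log_ratio (hzb z hz),
    hL' z hz.1, ratio_mul_ratio hna, ratio_mul_ratio hnb]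

lemma IsPreconnected.eq_of_exp_eq_one {S : Set Plane} (hS : IsPreconnected S) {G : Plane → ℂ}
    (hG : ContinuousOn G S) (h : ∀ z ∈ S, Complex.exp (G z) = 1) {x y : Plane} (hx : x ∈ S)
    (hy : y ∈ S) : G x = G y := by
  have hcount : {u : ℂ | Complex.exp u = 1}.Countable := by
    refine (countable_range fun n : ℤ => (n : ℂ) * (2 * Real.pi * Complex.I)).mono fun u hu => ?_
    obtain ⟨n, hn⟩ := Complex.exp_eq_one_iff.1 hu
    exact ⟨n, hn.symm⟩
  exact hcount.isTotallyDisconnected (G '' S) (image_subset_iff.2 h) (hS.image G hG)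
    (mem_image_of_mem G hx) (mem_image_of_mem G hy)

lemma exists_norm_smul_add_smul_lt (u v : Plane) {r : ℝ} (hr : 0 < r) :
    ∃ δ > 0, ∀ α β : ℝ, |α| < δ → |β| < δ → ‖α • u + β • v‖ < r := by
  have hp : 0 < ‖u‖ + ‖v‖ + 1 := by positivity
  refine ⟨r / (‖u‖ + ‖v‖ + 1), div_pos hr hp, fun α β hα hβ => ?_⟩
  calc ‖α • u + β • v‖ ≤ |α| * ‖u‖ + |β| * ‖v‖ := by
        refine (norm_add_le _ _).trans_eq ?_
        rw [norm_smul, norm_smul, Real.norm_eq_abs, Real.norm_eq_abs]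
    _ ≤ r / (‖u‖ + ‖v‖ + 1) * ‖u‖ + r / (‖u‖ + ‖v‖ + 1) * ‖v‖ := by gcongr
    _ = r / (‖u‖ + ‖v‖ + 1) * (‖u‖ + ‖v‖) := by ring
    _ < r / (‖u‖ + ‖v‖ + 1) * (‖u‖ + ‖v‖ + 1) := by
        exact mul_lt_mul_of_pos_left (lt_add_one _) (div_pos hr hp)
    _ = r := div_mul_cancel₀ r hp.ne'

/-- Local conicity in coordinates. -/
lemma LocallyConic.exists_coord {K : Set Plane} (h : LocallyConic K) (z u v : Plane) :
    ∃ δ > 0, ∀ α β : ℝ, |α| < δ → |β| < δ → ∀ t : ℝ, 0 < t → t ≤ 1 →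
      (z + t • (α • u + β • v) ∈ K ↔ z + (α • u + β • v) ∈ K) := by
  obtain ⟨r, hr, h⟩ := h z
  obtain ⟨δ, hδ, h'⟩ := exists_norm_smul_add_smul_lt u v hr
  refine ⟨δ, hδ, fun α β hα hβ t t0 t1 => ?_⟩
  have := h (z + (α • u + β • v)) (by rw [dist_eq_norm, add_sub_cancel_left]; exact h' α β hα hβ)
    t t0 t1
  rwa [add_sub_cancel_left] at this

/-- A thin open sector on one side of a ray is contained in or disjoint from a locally conic
set near the apex of the sector. -/
lemma LocallyConic.sector_subset_or_disjoint {K : Set Plane} (h : LocallyConic K)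
    (w u v : Plane) : ∃ ε > 0,
      (∀ α β : ℝ, 0 < α → α ≤ ε → 0 < β → β ≤ ε * α → w + (α • u + β • v) ∈ K) ∨
      (∀ α β : ℝ, 0 < α → α ≤ ε → 0 < β → β ≤ ε * α → w + (α • u + β • v) ∉ K) := by
  obtain ⟨δ, hδ, hw⟩ := h.exists_coord w u v
  set s := δ / 2 with hs
  have hs0 : 0 < s := by positivity
  obtain ⟨η, hη, hz⟩ := h.exists_coord (w + s • u) u v
  set σ := min η δ / 2 with hσ
  have hσ0 : 0 < σ := by positivity
  have hση : σ < η := by rw [hσ]; linarith [min_le_left η δ]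
  have hσδ : σ < δ := by rw [hσ]; linarith [min_le_right η δ]
  have key : ∀ α β : ℝ, 0 < α → α ≤ min s (σ / s) → 0 < β → β ≤ min s (σ / s) * α →
      (w + (α • u + β • v) ∈ K ↔ w + s • u + σ • v ∈ K) := by
    intro α β hα hα' hβ hβ'
    have hαs : α ≤ s := hα'.trans (min_le_left _ _)
    have hβs : β * s ≤ σ * α := by
      have : β ≤ σ / s * α := hβ'.trans (by gcongr; exact min_le_right _ _)
      rw [div_mul_eq_mul_div, le_div_iff₀ hs0] at this
      exact this
    have hq : s * β / α ≤ σ := by rw [div_le_iff₀ hα]; linarith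
    have hq0 : 0 < s * β / α := by positivity
    have h1 := hw s (s * β / α) (by rw [abs_of_pos hs0]; linarith)
      (by rw [abs_of_pos hq0]; linarith) (α / s) (by positivity) ((div_le_one hs0).2 hαs)
    have h2 := hz 0 σ (by simpa using hη) (by rw [abs_of_pos hσ0]; exact hση)
      (s * β / α / σ) (by positivity) ((div_le_one hσ0).2 hq)
    have e1 : (α / s) • (s • u + (s * β / α) • v) = α • u + β • v := by
      rw [smul_add, smul_smul, smul_smul]
      congr 2 <;> field_simp
    have e2 : (s * β / α / σ) • ((0 : ℝ) • u + σ • v) = (s * β / α) • v := by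
      rw [zero_smul, zero_add, smul_smul]
      congr 1
      field_simp
    rw [e1] at h1
    rw [e2, zero_smul, zero_add] at h2
    rw [h1, ← add_assoc, h2]
  refine ⟨min s (σ / s), lt_min hs0 (by positivity), ?_⟩
  by_cases hK : w + s • u + σ • v ∈ K
  · exact Or.inl fun α β h1 h2 h3 h4 => (key α β h1 h2 h3 h4).2 hK
  · exact Or.inr fun α β h1 h2 h3 h4 => mt (key α β h1 h2 h3 h4).1 hK

/-- A point of the open segment from `w` to `w + u` at which `K` is missing on the side of `v`
blocks the view from `w` to that side of `w + u`. -/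
lemma eventually_not_mem_visibleFrom_of_blocked {K : Set Plane} (h : LocallyConic K)
    {w u v : Plane} {t : ℝ} (ht0 : 0 < t) (ht1 : t < 1)
    (hb : ∀ δ > 0, ∃ α β : ℝ, |α| < δ ∧ 0 < β ∧ β < δ ∧ w + t • u + (α • u + β • v) ∉ K) :
    ∃ ε > 0, ∀ α β : ℝ, |α| < ε → 0 < β → β < ε →
      w + ((1 + α) • u + β • v) ∉ visibleFrom K w := by
  obtain ⟨δ, hδ, hc⟩ := h.exists_coord (w + t • u) u v
  obtain ⟨α₀, β₀, hα₀, hβ₀, hβ₀', hK⟩ := hb δ hδ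
  have hq : 0 < 1 + |α₀| / β₀ := by positivity
  refine ⟨min β₀ ((1 - t) / (1 + |α₀| / β₀)),
    lt_min hβ₀ (div_pos (by linarith) hq), fun α β hα hβ hβ' hvis => ?_⟩
  have hb1 : β < β₀ := hβ'.trans_le (min_le_left _ _)
  have hsum : |α| + β * (|α₀| / β₀) < 1 - t := by
    have h1 := hα.trans_le (min_le_right _ _)
    have h2 := hβ'.trans_le (min_le_right _ _)
    have h3 : β * (|α₀| / β₀) ≤ (1 - t) / (1 + |α₀| / β₀) * (|α₀| / β₀) := by gcongr
    have h4 : (1 - t) / (1 + |α₀| / β₀) + (1 - t) / (1 + |α₀| / β₀) * (|α₀| / β₀) = 1 - t := by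
      field_simp
    linarith
  set D := 1 + α - β * α₀ / β₀ with hD
  have hDt : t < D := by
    have h1 := neg_abs_le α
    have h2 : β * α₀ / β₀ ≤ β * (|α₀| / β₀) := by
      rw [mul_div_assoc]
      gcongr
      exact le_abs_self α₀
    rw [hD]
    linarith
  have hD0 : 0 < D := ht0.trans hDt
  have hκ1 : t / D ≤ 1 := (div_le_one hD0).2 hDt.le
  have hτ0 : 0 < t / D * β / β₀ := by positivity
  have hτ1 : t / D * β / β₀ ≤ 1 := by
    rw [div_le_one hβ₀]
    nlinarith
  have hmem := mem_visibleFrom_iff.1 hvis (t / D) (by positivity) hκ1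
  have hnot := mt (hc α₀ β₀ hα₀ (by rwa [abs_of_pos hβ₀]) _ hτ0 hτ1).1 hK
  apply hnot
  convert hmem using 1
  have e1 : t / D * (1 + α) = t + t / D * β / β₀ * α₀ := by
    have : 1 + α = D + β * α₀ / β₀ := by rw [hD]; ring
    rw [this]
    field_simp
  have e2 : t / D * β / β₀ * β₀ = t / D * β := by field_simp
  rw [add_sub_cancel_left, smul_add, smul_smul, smul_add, smul_smul, smul_smul, smul_smul, e1, e2,
    add_smul]
  abel

/-- Near an interior point `w + u` of `K`, the points on one side of the line from `w` are
either all visible or all invisible from `w`. -/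
lemma eventually_mem_visibleFrom_or_not {K : Set Plane} (h : LocallyConic K) {w u v : Plane}
    (hw : w ∈ K) (hx : w + u ∈ interior K) :
    ∃ ε > 0, (∀ α β : ℝ, |α| < ε → 0 < β → β < ε →
        w + ((1 + α) • u + β • v) ∈ visibleFrom K w) ∨
      (∀ α β : ℝ, |α| < ε → 0 < β → β < ε → w + ((1 + α) • u + β • v) ∉ visibleFrom K w) := by
  by_cases hnone : ∃ ε > 0, ∀ α β : ℝ, |α| < ε → 0 < β → β < ε →
      w + ((1 + α) • u + β • v) ∉ visibleFrom K w
  · obtain ⟨ε, hε, hn⟩ := hnone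
    exact ⟨ε, hε, Or.inr hn⟩
  obtain ⟨r, hr, hball⟩ := Metric.isOpen_iff.1 isOpen_interior _ hx
  obtain ⟨δ, hδ, hδ'⟩ := exists_norm_smul_add_smul_lt u v hr
  have hnear : ∀ α β : ℝ, |α| < δ → |β| < δ → w + ((1 + α) • u + β • v) ∈ K := by
    intro α β hα hβ
    refine interior_subset (hball ?_)
    have e : w + ((1 + α) • u + β • v) - (w + u) = α • u + β • v := by module
    rw [Metric.mem_ball, dist_eq_norm, e]
    exact hδ' α β hα hβ
  obtain ⟨ε₀, hε₀, hsec⟩ := h.sector_subset_or_disjoint w u v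
  have hsec : ∀ α β : ℝ, 0 < α → α ≤ ε₀ → 0 < β → β ≤ ε₀ * α → w + (α • u + β • v) ∈ K := by
    refine hsec.resolve_right fun hout => hnone ?_
    refine ⟨min (1 / 2) (ε₀ / 2), by positivity, fun α β hα hβ hβ' hvis => ?_⟩
    have hα1 := abs_lt.1 (hα.trans_le (min_le_left _ _))
    have hβ1 := hβ'.trans_le (min_le_right _ _)
    set κ := min 1 (ε₀ / 2) with hκ
    have hκ0 : 0 < κ := by positivity
    have hκ1 : κ ≤ 1 := min_le_left _ _
    have hκ2 : κ ≤ ε₀ / 2 := min_le_right _ _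
    have hmem := mem_visibleFrom_iff.1 hvis κ hκ0.le hκ1
    rw [add_sub_cancel_left, smul_add, smul_smul, smul_smul] at hmem
    refine hout _ _ (mul_pos hκ0 (by linarith)) (by nlinarith) (mul_pos hκ0 hβ) ?_ hmem
    have : β ≤ ε₀ * (1 + α) := by nlinarith
    nlinarith
  have hopen : ∀ t ∈ Icc ε₀ 1, ∃ η > 0, ∀ α β : ℝ, |α| < η → 0 < β → β < η →
      w + t • u + (α • u + β • v) ∈ K := by
    rintro t ⟨ht0, ht1⟩
    rcases ht1.eq_or_lt with rfl | ht1
    · refine ⟨δ, hδ, fun α β hα hβ hβ' => ?_⟩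
      have := hnear α β hα (by rwa [abs_of_pos hβ])
      convert this using 1
      module
    · by_contra! hcon
      exact hnone (eventually_not_mem_visibleFrom_of_blocked h (hε₀.trans_le ht0) ht1
        fun η hη => hcon η hη)
  obtain ⟨ε₁, hε₁, hstrip⟩ : ∃ ε > 0, ∀ t ∈ Icc ε₀ 1, ∀ β : ℝ, 0 < β → β < ε →
      w + (t • u + β • v) ∈ K := by
    refine isCompact_Icc.induction_on (p := fun s => ∃ ε > 0, ∀ t ∈ s, ∀ β : ℝ, 0 < β → β < ε →
      w + (t • u + β • v) ∈ K) ⟨1, one_pos, by simp⟩ ?_ ?_ ?_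
    · rintro s s' hss ⟨ε, hε, hs⟩
      exact ⟨ε, hε, fun t ht => hs t (hss ht)⟩
    · rintro s s' ⟨ε, hε, hs⟩ ⟨ε', hε', hs'⟩
      refine ⟨min ε ε', lt_min hε hε', ?_⟩
      rintro t (ht | ht) β hβ hβ'
      · exact hs t ht β hβ (hβ'.trans_le (min_le_left _ _))
      · exact hs' t ht β hβ (hβ'.trans_le (min_le_right _ _))
    · intro t ht
      obtain ⟨η, hη, ho⟩ := hopen t ht
      refine ⟨Metric.ball t η, mem_nhdsWithin_of_mem_nhds (Metric.ball_mem_nhds t hη), η, hη,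
        fun s hs β hβ hβ' => ?_⟩
      have := ho (s - t) β hs hβ hβ'
      convert this using 1
      module
  refine ⟨min (min (1 / 2) δ) (min (ε₀ / 2) ε₁), by positivity,
    Or.inl fun α β hα hβ hβ' => mem_visibleFrom_iff.2 fun τ τ0 τ1 => ?_⟩
  have hα1 := abs_lt.1 (hα.trans_le ((min_le_left _ _).trans (min_le_left _ _)))
  have hα2 := hα.trans_le ((min_le_left _ _).trans (min_le_right _ _))
  have hβ1 := hβ'.trans_le ((min_le_left _ _).trans (min_le_right _ _))
  have hβ2 := hβ'.trans_le ((min_le_right _ _).trans (min_le_left _ _))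
  have hβ3 := hβ'.trans_le ((min_le_right _ _).trans (min_le_right _ _))
  rcases τ0.eq_or_lt with rfl | τ0
  · simpa using hw
  rw [add_sub_cancel_left, smul_add, smul_smul, smul_smul]
  have hτβ : 0 < τ * β := mul_pos τ0 hβ
  have hτβ' : τ * β ≤ β := mul_le_of_le_one_left hβ.le τ1
  have hpos : 0 < τ * (1 + α) := mul_pos τ0 (by linarith)
  by_cases h1 : τ * (1 + α) ≤ ε₀
  · refine hsec _ _ hpos h1 hτβ ?_
    have : β ≤ ε₀ * (1 + α) := by nlinarith
    nlinarith
  · by_cases h2 : τ * (1 + α) ≤ 1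
    · exact hstrip _ ⟨(not_le.1 h1).le, h2⟩ _ hτβ (hτβ'.trans_lt hβ3)
    · have := hnear (τ * (1 + α) - 1) (τ * β) ?_ ?_
      · rwa [add_sub_cancel] at this
      · have hpos' : 0 < α := by nlinarith
        rw [abs_of_pos hpos'] at hα2
        rw [abs_of_nonneg (by linarith)]
        nlinarith
      · rw [abs_of_pos hτβ]
        linarith

lemma cross_add_smul (u p q : Plane) (t : ℝ) : cross u (p + t • q) = cross u p + t * cross u q := by
  simp only [cross, PiLp.add_apply, PiLp.smul_apply, smul_eq_mul]
  ring

lemma cross_smul_left (u p : Plane) (t : ℝ) : cross (t • u) p = t * cross u p := by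
  simp only [cross, PiLp.smul_apply, smul_eq_mul]
  ring

lemma cross_self_eq_zero (u : Plane) : cross u u = 0 := by
  simp only [cross]
  ring

lemma exists_cross_pos {u : Plane} (hu : u ≠ 0) : ∃ v, 0 < cross u v := by
  refine ⟨!₂[-u 1, u 0], ?_⟩
  have : cross u !₂[-u 1, u 0] = u 0 * u 0 + u 1 * u 1 := by simp [cross]
  rw [this]
  by_contra! h
  have h0 : u 0 = 0 := by nlinarith [mul_self_nonneg (u 0), mul_self_nonneg (u 1)]
  have h1 : u 1 = 0 := by nlinarith [mul_self_nonneg (u 0), mul_self_nonneg (u 1)]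
  apply hu
  ext i
  fin_cases i
  · exact h0
  · exact h1

lemma cross_smul_eq (u v y : Plane) : cross u v • y = cross y v • u + cross u y • v := by
  ext i
  fin_cases i <;>
  · simp only [cross, Fin.zero_eta, Fin.mk_one, PiLp.add_apply, PiLp.smul_apply, smul_eq_mul]
    ring

lemma exists_eq_smul_of_cross_eq_zero {u p : Plane} (hu : u ≠ 0) (h : cross u p = 0) :
    ∃ c : ℝ, p = c • u := by
  obtain ⟨v, hv⟩ := exists_cross_pos hu
  refine ⟨(cross u v)⁻¹ * cross p v, ?_⟩
  have := cross_smul_eq u v p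
  rw [h, zero_smul, add_zero] at this
  rw [mul_smul, ← this, smul_smul, inv_mul_cancel₀ hv.ne', one_smul]

lemma halfPlane_subset_closure {u : Plane} (hu : u ≠ 0) (w : Plane) {σ : ℝ} (hσ : σ ≠ 0) :
    {y | 0 ≤ σ * cross u (y - w)} ⊆ closure {y | 0 < σ * cross u (y - w)} := by
  intro y hy
  obtain ⟨v, hv⟩ := exists_cross_pos hu
  have hlim : Filter.Tendsto (fun t : ℝ => y + t • σ • v) (𝓝[>] 0) (𝓝 y) := by
    have : Continuous fun t : ℝ => y + t • σ • v := by fun_prop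
    simpa using (this.tendsto 0).mono_left nhdsWithin_le_nhds
  refine mem_closure_of_tendsto hlim ?_
  filter_upwards [self_mem_nhdsWithin] with t ht
  have ht : 0 < t := ht
  have hy : 0 ≤ σ * cross u (y - w) := hy
  have e : y + t • σ • v - w = y - w + (t * σ) • v := by module
  change 0 < σ * cross u (y + t • σ • v - w)
  rw [e, cross_add_smul]
  have : 0 < t * (σ * σ) * cross u v := by
    have := mul_self_pos.2 hσ
    positivity
  nlinarith

lemma dense_cross_ne_zero {u : Plane} (hu : u ≠ 0) (w : Plane) :
    Dense {y | cross u (y - w) ≠ 0} := by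
  intro y
  by_cases h : cross u (y - w) = 0
  · refine closure_mono ?_ (halfPlane_subset_closure hu w one_ne_zero
      (by simp [h] : y ∈ {y | 0 ≤ 1 * cross u (y - w)}))
    intro z hz
    have hz : 0 < 1 * cross u (z - w) := hz
    rw [one_mul] at hz
    exact hz.ne'
  · exact subset_closure h

lemma eventually_nonneg_side {V : Set Plane} (hV : IsClosed V) {u w x : Plane} (hu : u ≠ 0) {σ : ℝ}
    (hσ : σ ≠ 0) (h : ∀ᶠ y in 𝓝 x, 0 < σ * cross u (y - w) → y ∈ V) :
    ∀ᶠ y in 𝓝 x, 0 ≤ σ * cross u (y - w) → y ∈ V := by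
  obtain ⟨U, hU, hUo, hxU⟩ := eventually_nhds_iff.1 h
  filter_upwards [hUo.mem_nhds hxU] with y hy hy'
  refine closure_minimal ?_ hV
    (hUo.inter_closure ⟨hy, halfPlane_subset_closure hu w hσ hy'⟩)
  exact fun z hz => hU z hz.1 hz.2

/-- Near an interior point of `K`, the points on one given side of the line from `w` are either
all visible or all invisible from `w`. -/
lemma eventually_side_mem_visibleFrom_or_not {K : Set Plane} (h : LocallyConic K) {w x : Plane}
    (hw : w ∈ K) (hx : x ∈ interior K) (hxw : x ≠ w) {σ : ℝ} (hσ : σ ≠ 0) :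
    (∀ᶠ y in 𝓝 x, 0 < σ * cross (x - w) (y - w) → y ∈ visibleFrom K w) ∨
      (∀ᶠ y in 𝓝 x, 0 < σ * cross (x - w) (y - w) → y ∉ visibleFrom K w) := by
  have hu : x - w ≠ 0 := sub_ne_zero.2 hxw
  obtain ⟨v, hv⟩ := exists_cross_pos hu
  set N := cross (x - w) v with hN
  have hα : Continuous fun y => cross (y - w) v / N - 1 := by fun_prop
  have hβ : Continuous fun y => cross (x - w) (y - w) / (σ * N) := by fun_prop
  obtain ⟨ε, hε, hd⟩ := eventually_mem_visibleFrom_or_not (v := σ • v) h hw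
    (show w + (x - w) ∈ interior K by rwa [add_sub_cancel])
  have hα0 : ∀ᶠ y in 𝓝 x, |cross (y - w) v / N - 1| < ε := by
    refine hα.abs.continuousAt.eventually_lt continuousAt_const ?_
    rw [← hN, div_self hv.ne', sub_self, abs_zero]
    exact hε
  have hβ0 : ∀ᶠ y in 𝓝 x, cross (x - w) (y - w) / (σ * N) < ε := by
    refine hβ.continuousAt.eventually_lt continuousAt_const ?_
    rw [cross_self_eq_zero, zero_div]
    exact hε
  have hrep : ∀ y, w + ((1 + (cross (y - w) v / N - 1)) • (x - w) +
      (cross (x - w) (y - w) / (σ * N)) • σ • v) = y := by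
    intro y
    have h1 := cross_smul_eq (x - w) v (y - w)
    rw [← hN] at h1
    have h2 : y - w = N⁻¹ • (cross (y - w) v • (x - w) + cross (x - w) (y - w) • v) := by
      rw [← h1, smul_smul, inv_mul_cancel₀ hv.ne', one_smul]
    have h3 : cross (x - w) (y - w) / (σ * N) * σ = N⁻¹ * cross (x - w) (y - w) := by
      field_simp
    rw [smul_smul, h3, add_sub_cancel, div_eq_inv_mul, mul_smul, mul_smul, ← smul_add, ← h2,
      add_sub_cancel]
  have hpos : ∀ y, 0 < σ * cross (x - w) (y - w) → 0 < cross (x - w) (y - w) / (σ * N) := by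
    intro y hy
    have e : cross (x - w) (y - w) / (σ * N) =
        σ * cross (x - w) (y - w) / (σ * σ * N) := by field_simp
    rw [e]
    have := mul_self_pos.2 hσ
    positivity
  refine hd.imp (fun hd => ?_) (fun hd => ?_) <;>
  · filter_upwards [hα0, hβ0] with y h1 h2 h3
    have := hd _ _ h1 (hpos y h3) h2
    rwa [hrep] at this

/-- Near a frontier point of a regular visibility region that is interior to `K`, the visibility
region is a closed half-plane bounded by the line from `w`. -/
lemma exists_eventually_mem_visibleFrom_iff {K : Set Plane} (hK : IsClosed K) (h : LocallyConic K)
    {w x : Plane} (hw : w ∈ K) (hreg : visibleFrom K w = closure (interior (visibleFrom K w)))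
    (hx : x ∈ interior K) (hxw : x ≠ w) (hxf : x ∈ frontier (visibleFrom K w)) :
    ∃ σ : ℝ, σ ≠ 0 ∧
      ∀ᶠ y in 𝓝 x, (y ∈ visibleFrom K w ↔ 0 ≤ σ * cross (x - w) (y - w)) := by
  have hu : x - w ≠ 0 := sub_ne_zero.2 hxw
  have hV := isClosed_visibleFrom hK w
  have hn1 : (-1 : ℝ) ≠ 0 := by norm_num
  rcases eventually_side_mem_visibleFrom_or_not h hw hx hxw one_ne_zero with h1 | h1 <;>
  rcases eventually_side_mem_visibleFrom_or_not h hw hx hxw hn1 with h2 | h2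
  · exfalso
    refine hxf.2 (mem_interior_iff_mem_nhds.2 ?_)
    filter_upwards [eventually_nonneg_side hV hu one_ne_zero h1,
      eventually_nonneg_side hV hu hn1 h2] with y h3 h4
    rcases le_total 0 (cross (x - w) (y - w)) with h5 | h5
    · exact h3 (by linarith)
    · exact h4 (by linarith)
  · refine ⟨1, one_ne_zero, ?_⟩
    filter_upwards [eventually_nonneg_side hV hu one_ne_zero h1, h2] with y h3 h4
    refine ⟨fun h5 => ?_, h3⟩
    by_contra! h6
    exact h4 (by linarith) h5
  · refine ⟨-1, hn1, ?_⟩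
    filter_upwards [eventually_nonneg_side hV hu hn1 h2, h1] with y h3 h4
    refine ⟨fun h5 => ?_, h3⟩
    by_contra! h6
    exact h4 (by linarith) h5
  · exfalso
    obtain ⟨U, hU, hUo, hxU⟩ := eventually_nhds_iff.1 (h1.and h2)
    have hxV : x ∈ closure (interior (visibleFrom K w)) := hreg ▸ hV.frontier_subset hxf
    obtain ⟨y, ⟨hyU, hyV⟩, hy⟩ := (dense_cross_ne_zero hu w).inter_open_nonempty _
      (hUo.inter isOpen_interior) (mem_closure_iff.1 hxV U hUo hxU)
    rcases lt_or_gt_of_ne hy with h5 | h5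
    · exact (hU y hyU).2 (by linarith) (interior_subset hyV)
    · exact (hU y hyU).1 (by linarith) (interior_subset hyV)

lemma mem_interior_visibleFrom_self {K : Set Plane} {w : Plane} (hw : w ∈ interior K) :
    w ∈ interior (visibleFrom K w) := by
  obtain ⟨r, hr, h⟩ := Metric.isOpen_iff.1 isOpen_interior w hw
  refine mem_interior.2 ⟨_, fun y hy => ?_, Metric.isOpen_ball, Metric.mem_ball_self hr⟩
  exact ((convex_ball w r).segment_subset (Metric.mem_ball_self hr) hy).trans
    (h.trans interior_subset)

lemma LocallyConic.ball_inter_subset_visibleFrom {K : Set Plane} (h : LocallyConic K) {w : Plane}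
    (hw : w ∈ K) : ∃ r > 0, Metric.ball w r ∩ K ⊆ visibleFrom K w := by
  obtain ⟨r, hr, h⟩ := h w
  refine ⟨r, hr, fun y hy => mem_visibleFrom_iff.2 fun t t0 t1 => ?_⟩
  rcases t0.eq_or_lt with rfl | t0
  · simpa using hw
  · exact (h y hy.1 t t0 t1).2 hy.2

/-- A segment in the frontier of a visibility region that crosses the interior of `K` does not
start at the viewpoint. -/
lemma false_of_segment_subset_frontier {K : Set Plane} (h : LocallyConic K) {w b : Plane}
    (hw : w ∈ K) (he : segment ℝ w b ⊆ frontier (visibleFrom K w))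
    (hseg : openSegment ℝ w b ⊆ interior K) : False := by
  obtain ⟨r, hr, hball⟩ := h.ball_inter_subset_visibleFrom hw
  have hopen : IsOpen (Metric.ball w r ∩ interior K) := Metric.isOpen_ball.inter isOpen_interior
  have hsub : Metric.ball w r ∩ interior K ⊆ interior (visibleFrom K w) :=
    interior_maximal ((inter_subset_inter_right _ interior_subset).trans hball) hopen
  have hw' : w ∈ closure (openSegment ℝ w b) :=
    segment_subset_closure_openSegment (left_mem_segment ℝ w b)
  obtain ⟨y, hyb, hy⟩ := mem_closure_iff.1 hw' _ Metric.isOpen_ball (Metric.mem_ball_self hr)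
  exact (he (openSegment_subset_segment ℝ w b hy)).2 (hsub ⟨hyb, hseg hy⟩)

/-- The structure of a window of a regular visibility region: it lies on a line through the
viewpoint, does not contain it, and near its midpoint the visibility region is one of the
closed half-planes bounded by that line. -/
lemma window_structure {K : Set Plane} (hK : IsClosed K) (h : LocallyConic K)
    {w a b : Plane} (hw : w ∈ K)
    (hreg : visibleFrom K w = closure (interior (visibleFrom K w))) (hab : a ≠ b)
    (he : segment ℝ a b ⊆ frontier (visibleFrom K w))
    (hfr : segment ℝ a b ∩ frontier K = {a, b}) :
    midpoint ℝ a b ∈ interior K ∧ cross (b - a) (w - a) = 0 ∧ w ∉ segment ℝ a b ∧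
      ∃ σ : ℝ, σ ≠ 0 ∧ ∀ᶠ y in 𝓝 (midpoint ℝ a b),
        (y ∈ visibleFrom K w ↔ 0 ≤ σ * cross (b - a) (y - a)) := by
  have hV := isClosed_visibleFrom hK w
  have hd : b - a ≠ 0 := sub_ne_zero.2 hab.symm
  have hseg : openSegment ℝ a b ⊆ interior K := by
    intro y hy
    have hye := openSegment_subset_segment ℝ a b hy
    by_contra hyK
    have hyf : y ∈ frontier K := by
      rw [hK.frontier_eq]
      exact ⟨visibleFrom_subset (hV.frontier_subset (he hye)), hyK⟩
    have : y ∈ ({a, b} : Set Plane) := hfr ▸ ⟨hye, hyf⟩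
    rcases this with rfl | rfl
    · exact hab (left_mem_openSegment_iff.1 hy)
    · exact hab (right_mem_openSegment_iff.1 hy)
  have hxo : midpoint ℝ a b ∈ openSegment ℝ a b := by
    refine ⟨1 / 2, 1 / 2, by norm_num, by norm_num, by norm_num, ?_⟩
    rw [midpoint_eq_smul_add, smul_add, invOf_eq_inv, one_div]
  have hxe := openSegment_subset_segment ℝ a b hxo
  have hwe : w ∉ segment ℝ a b := by
    intro hwe
    have hwK : w ∉ interior K := fun hwi => (he hwe).2 (mem_interior_visibleFrom_self hwi)
    have : w ∈ ({a, b} : Set Plane) := by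
      rw [← hfr, hK.frontier_eq]
      exact ⟨hwe, hw, hwK⟩
    rcases this with rfl | rfl
    · exact false_of_segment_subset_frontier h hw he hseg
    · rw [segment_symm] at he
      rw [openSegment_symm] at hseg
      exact false_of_segment_subset_frontier h hw he hseg
  set x := midpoint ℝ a b with hxdef
  have hxa : x = a + (1 / 2 : ℝ) • (b - a) := by
    rw [hxdef, midpoint_eq_smul_add, invOf_eq_inv]
    module
  have hxw : x ≠ w := fun h => hwe (h ▸ hxe)
  obtain ⟨σ, hσ, hloc⟩ := exists_eventually_mem_visibleFrom_iff hK h hw hreg (hseg hxo) hxw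
    (he hxe)
  have hzero : ∀ᶠ y in 𝓝 x, y ∈ frontier (visibleFrom K w) → cross (x - w) (y - w) = 0 := by
    filter_upwards [eventually_eventually_nhds.2 hloc] with y hy hyf
    have hyV : 0 ≤ σ * cross (x - w) (y - w) :=
      hy.self_of_nhds.1 (hV.frontier_subset hyf)
    by_contra hne
    have hpos : 0 < σ * cross (x - w) (y - w) := lt_of_le_of_ne hyV (mul_ne_zero hσ hne).symm
    refine hyf.2 (mem_interior_iff_mem_nhds.2 ?_)
    have hcont : Continuous fun z => σ * cross (x - w) (z - w) := by fun_prop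
    filter_upwards [hy, hcont.continuousAt.eventually_const_lt hpos] with z hz hz'
    exact hz.2 hz'.le
  have hlim : Filter.Tendsto (fun t : ℝ => x + t • (b - a)) (𝓝[>] 0) (𝓝 x) := by
    have : Continuous fun t : ℝ => x + t • (b - a) := by fun_prop
    simpa using (this.tendsto 0).mono_left nhdsWithin_le_nhds
  have hcross : cross (x - w) (b - a) = 0 := by
    obtain ⟨t, ht, ht0, ht1⟩ := ((hlim.eventually hzero).and
      (Ioo_mem_nhdsGT (show (0 : ℝ) < 1 / 2 by norm_num))).exists
    have e : x + t • (b - a) - w = (x - w) + t • (b - a) := by abel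
    rw [e, cross_add_smul, cross_self_eq_zero, zero_add] at ht
    refine (mul_eq_zero.1 (ht (he (mem_segment_iff_exists_add_smul.2
      ⟨1 / 2 + t, by linarith, by linarith, ?_⟩)))).resolve_left ht0.ne'
    rw [hxa]
    module
  have hcross' : cross (b - a) (x - w) = 0 := by
    rw [← neg_eq_zero, ← hcross]
    simp only [cross]
    ring
  obtain ⟨c, hc⟩ := exists_eq_smul_of_cross_eq_zero hd hcross'
  have hc0 : c ≠ 0 := by
    rintro rfl
    exact hxw (sub_eq_zero.1 (hc.trans (zero_smul ℝ _)))
  have hwa : w - a = (1 / 2 - c) • (b - a) := by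
    have : w = x - c • (b - a) := by rw [← hc]; abel
    rw [this, hxa]
    module
  have hline : cross (b - a) (w - a) = 0 := by
    rw [hwa]
    have := cross_add_smul (b - a) 0 (b - a) (1 / 2 - c)
    rw [zero_add, cross_self_eq_zero, mul_zero, add_zero] at this
    rw [this]
    simp [cross]
  refine ⟨hseg hxo, hline, hwe, σ * c, mul_ne_zero hσ hc0, ?_⟩
  filter_upwards [hloc] with y hy
  have e : y - w = (y - a) + (-1 : ℝ) • (w - a) := by module
  rw [hy, hc, cross_smul_left, e, cross_add_smul, hline, mul_zero, add_zero, mul_assoc]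

lemma cross_eq_zero_of_mem_segment {a b y : Plane} (hy : y ∈ segment ℝ a b) :
    cross (b - a) (y - a) = 0 := by
  obtain ⟨t, -, -, rfl⟩ := mem_segment_iff_exists_add_smul.1 hy
  simp only [cross, add_sub_cancel_left, PiLp.smul_apply, smul_eq_mul]
  ring

/-- Removing a segment on a line through the viewpoint that does not contain the viewpoint leaves
a regular visibility region connected. -/
lemma isPreconnected_visibleFrom_diff {K : Set Plane} {w a b : Plane} (hw : w ∈ K)
    (hreg : visibleFrom K w = closure (interior (visibleFrom K w))) (hab : a ≠ b)
    (hline : cross (b - a) (w - a) = 0) (hwe : w ∉ segment ℝ a b) :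
    IsPreconnected (visibleFrom K w \ segment ℝ a b) := by
  have hd : b - a ≠ 0 := sub_ne_zero.2 hab.symm
  set A : Set Plane := {w} ∪ {q ∈ visibleFrom K w | cross (b - a) (q - a) ≠ 0} with hA
  have hwV : w ∈ visibleFrom K w := by
    simpa [visibleFrom, segment_same] using hw
  have hstar : StarConvex ℝ w A := by
    rw [starConvex_iff_segment_subset]
    intro q hq y hy
    obtain ⟨t, t0, t1, rfl⟩ := mem_segment_iff_exists_add_smul.1 hy
    rcases hq with rfl | ⟨hqV, hq⟩
    · left
      simp
    rcases t0.eq_or_lt with rfl | t0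
    · left
      simp
    right
    refine ⟨mem_visibleFrom_iff.2 fun s s0 s1 => ?_, ?_⟩
    · rw [add_sub_cancel_left, smul_smul]
      exact mem_visibleFrom_iff.1 hqV _ (by positivity) (mul_le_one₀ s1 t0.le t1)
    · have e : w + t • (q - w) - a = (1 - t) • (w - a) + t • (q - a) := by module
      have e2 := cross_add_smul (b - a) 0 (w - a) (1 - t)
      rw [zero_add, hline, mul_zero, add_zero] at e2
      rw [e, cross_add_smul, e2]
      have : cross (b - a) 0 = 0 := by simp [cross]
      rw [this, zero_add]
      exact mul_ne_zero t0.ne' hq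
  have hApre : IsPreconnected A :=
    (hstar.isPathConnected (Or.inl rfl)).isConnected.isPreconnected
  refine hApre.subset_closure ?_ ?_
  · rintro q (rfl | ⟨hqV, hq⟩)
    · exact ⟨hwV, hwe⟩
    · exact ⟨hqV, fun hqe => hq (cross_eq_zero_of_mem_segment hqe)⟩
  · refine sdiff_subset.trans ?_
    rw [hreg]
    refine closure_minimal ?_ isClosed_closure
    refine ((dense_cross_ne_zero hd a).open_subset_closure_inter isOpen_interior).trans
      (closure_mono ?_)
    rintro q ⟨hqi, hq⟩
    exact Or.inr ⟨interior_subset hqi, hq⟩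

open Complex in
lemma pi_lt_arg_sub_arg {z₁ z₂ : ℂ} (h₁ : z₁.re < 0) (h₂ : z₂.re < 0) (h₁' : 0 < z₁.im)
    (h₂' : z₂.im < 0) : Real.pi < arg z₁ - arg z₂ := by
  have hp₁ : 0 ≤ arg z₁ := arg_nonneg_iff.2 h₁'.le
  have hn₂ : arg z₂ < 0 := arg_neg_iff.2 h₂'
  have e₁ : ¬ |arg z₁| ≤ Real.pi / 2 := fun h =>
    (abs_arg_le_pi_div_two_iff.1 h).not_gt h₁
  have e₂ : ¬ |arg z₂| ≤ Real.pi / 2 := fun h =>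
    (abs_arg_le_pi_div_two_iff.1 h).not_gt h₂
  rw [abs_of_nonneg hp₁] at e₁
  rw [abs_of_neg hn₂] at e₂
  linarith

/-- If a set `N` disjoint from the visibility region accumulates along a window, it does not
accumulate at any visible point off that window. -/
lemma mem_segment_of_mem_closure {K N : Set Plane} (hK : IsClosed K) (h : LocallyConic K)
    (hc : IsPreconnected Kᶜ) {w a b q : Plane} (hw : w ∈ K)
    (hreg : visibleFrom K w = closure (interior (visibleFrom K w))) (hab : a ≠ b)
    (he : segment ℝ a b ⊆ frontier (visibleFrom K w))
    (hfr : segment ℝ a b ∩ frontier K = {a, b}) (hN : IsPreconnected N)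
    (hNV : N ⊆ K \ visibleFrom K w) (heN : segment ℝ a b ⊆ closure N)
    (hqV : q ∈ visibleFrom K w) (hqN : q ∈ closure N) : q ∈ segment ℝ a b := by
  by_contra hq
  have hV := isClosed_visibleFrom hK w
  obtain ⟨hxi, hline, hwe, σ, hσ, hloc⟩ := window_structure hK h hw hreg hab he hfr
  have hab' : ({a, b} : Set Plane) ⊆ segment ℝ a b := hfr ▸ inter_subset_left
  have habK : ({a, b} : Set Plane) ⊆ frontier K := hfr ▸ inter_subset_right
  obtain ⟨L, hL, hexp⟩ := exists_log_ratio_of_mem_frontier hK h hc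
    (habK (Or.inl rfl)) (habK (Or.inr rfl))
  set x := midpoint ℝ a b with hxdef
  have hxo : x ∈ openSegment ℝ a b := by
    refine ⟨1 / 2, 1 / 2, by norm_num, by norm_num, by norm_num, ?_⟩
    rw [hxdef, midpoint_eq_smul_add, smul_add, invOf_eq_inv, one_div]
  have hxe := openSegment_subset_segment ℝ a b hxo
  have hxab : x ∉ ({a, b} : Set Plane) := fun hx =>
    (habK hx).2 hxi
  have hxa : x ≠ a := fun hx => hxab (Or.inl hx)
  set G : Plane → ℂ := fun z => L z - Complex.log (ratio a b z) with hG
  have hGc : ContinuousOn G (K \ segment ℝ a b) :=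
    (hL.mono (sdiff_subset_sdiff_right hab')).sub
      ((continuousOn_log_ratio a b).mono fun z hz => hz.2)
  have hGe : ∀ z ∈ K \ segment ℝ a b, Complex.exp (G z) = 1 := by
    intro z hz
    have hne : Complex.exp (Complex.log (ratio a b z)) ≠ 0 := Complex.exp_ne_zero _
    rw [hG, Complex.exp_sub, hexp z ⟨hz.1, fun h => hz.2 (hab' h)⟩, exp_log_ratio hz.2, div_self]
    rwa [exp_log_ratio hz.2] at hne
  have hVsub : visibleFrom K w \ segment ℝ a b ⊆ K \ segment ℝ a b :=
    sdiff_subset_sdiff_left visibleFrom_subset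
  have hNsub : insert q N ⊆ K \ segment ℝ a b := by
    rintro z (rfl | hz)
    · exact ⟨visibleFrom_subset hqV, hq⟩
    · exact ⟨(hNV hz).1, fun hze => (hNV hz).2 (hV.frontier_subset (he hze))⟩
  have hNpre : IsPreconnected (insert q N) :=
    hN.subset_closure (subset_insert q N) (insert_subset hqN subset_closure)
  have hVconst : ∀ z ∈ visibleFrom K w \ segment ℝ a b, G z = G q := fun z hz =>
    (isPreconnected_visibleFrom_diff hw hreg hab hline hwe).eq_of_exp_eq_one (hGc.mono hVsub)
      (fun y hy => hGe y (hVsub hy)) hz ⟨hqV, hq⟩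
  have hNconst : ∀ z ∈ N, G z = G q := fun z hz =>
    hNpre.eq_of_exp_eq_one (hGc.mono hNsub) (fun y hy => hGe y (hNsub hy)) (Or.inr hz) (Or.inl rfl)
  have hLx : ContinuousAt L x := hL.continuousAt (Filter.inter_mem
    (mem_interior_iff_mem_nhds.1 hxi) ((toFinite {a, b}).isClosed.isOpen_compl.mem_nhds hxab))
  have hLim : ∀ᶠ y in 𝓝 x, |(L y).im - (L x).im| < 1 := by
    have hc : ContinuousAt (fun y => |(L y).im - (L x).im|) x :=
      ((Complex.continuous_im.continuousAt.comp hLx).sub continuousAt_const).abs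
    exact hc.eventually_lt continuousAt_const (by simp)
  have hre : ∀ᶠ y in 𝓝 x, (ratio a b y).re < 0 := by
    have hc : ContinuousAt (fun y => (ratio a b y).re) x :=
      Complex.continuous_re.continuousAt.comp
        ((continuousOn_ratio a b).continuousAt (isOpen_compl_singleton.mem_nhds hxa))
    exact hc.eventually_lt continuousAt_const (ratio_re_neg_of_mem_openSegment hab hxo)
  obtain ⟨U, hU, hUo, hxU⟩ := eventually_nhds_iff.1 (hloc.and (hLim.and hre))
  obtain ⟨y, hyU, hyN⟩ := mem_closure_iff.1 (heN hxe) U hUo hxU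
  have hxH : x ∈ closure {y | 0 < σ * cross (b - a) (y - a)} :=
    halfPlane_subset_closure (sub_ne_zero.2 hab.symm) a hσ
      (by simp [cross_eq_zero_of_mem_segment hxe])
  obtain ⟨z, hzU, hz⟩ := mem_closure_iff.1 hxH U hUo hxU
  have hz : 0 < σ * cross (b - a) (z - a) := hz
  obtain ⟨hy₁, hy₂, hy₃⟩ := hU y hyU
  obtain ⟨hz₁, hz₂, hz₃⟩ := hU z hzU
  have hy : σ * cross (b - a) (y - a) < 0 := by
    by_contra! hcon
    exact (hNV hyN).2 (hy₁.2 hcon)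
  have hze : z ∉ segment ℝ a b := fun hze => by
    rw [cross_eq_zero_of_mem_segment hze, mul_zero] at hz
    exact hz.false
  have hGy := congrArg Complex.im (hNconst y hyN)
  have hGz := congrArg Complex.im (hVconst z ⟨hz₁.2 hz.le, hze⟩)
  simp only [hG, Complex.sub_im, Complex.log_im] at hGy hGz
  rw [abs_lt] at hy₂ hz₂
  have hpi := Real.pi_gt_three
  rcases lt_or_gt_of_ne hσ with hs | hs
  · have := pi_lt_arg_sub_arg hy₃ hz₃ (im_ratio_pos (pos_of_mul_neg_right hy hs.le))
      (im_ratio_neg (neg_of_mul_pos_right hz hs.le))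
    linarith
  · have := pi_lt_arg_sub_arg hz₃ hy₃ (im_ratio_pos (pos_of_mul_pos_right hz hs.le))
      (im_ratio_neg (neg_of_mul_neg_right hy hs.le))
    linarith

/-- A component `N` of `S` accumulating at `x` contains every preconnected subset of `S` that
contains a whole neighbourhood of `x` in `S`. -/
lemma IsCompOf.subset_of_mem_closure {N S H : Set Plane} {x : Plane} (hN : IsCompOf N S)
    (hx : x ∈ closure N) {U : Set Plane} (hU : U ∈ 𝓝 x) (hH : IsPreconnected H) (hHS : H ⊆ S)
    (hUH : S ∩ U ⊆ H) : (N ∩ H).Nonempty ∧ H ⊆ N := by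
  obtain ⟨p, hp, rfl⟩ := hN
  obtain ⟨y, hyU, hy⟩ := mem_closure_iff_nhds.1 hx U hU
  have hyH : y ∈ H := hUH ⟨connectedComponentIn_subset _ _ hy, hyU⟩
  refine ⟨⟨y, hy, hyH⟩, ?_⟩
  rw [connectedComponentIn_eq hy]
  exact hH.subset_connectedComponentIn hyH hHS

lemma IsCompOf.eq_of_mem {M N S : Set Plane} {x : Plane} (hM : IsCompOf M S) (hN : IsCompOf N S)
    (hxM : x ∈ M) (hxN : x ∈ N) : M = N := by
  obtain ⟨p, hp, rfl⟩ := hM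
  obtain ⟨q, hq, rfl⟩ := hN
  rw [connectedComponentIn_eq hxM, connectedComponentIn_eq hxN]

/-- Near the midpoint of a window the non-visible region is an open half-disc. -/
lemma SimplePolygon.exists_nVis_inter_subset (P : SimplePolygon) {W : Set Plane}
    (hW : P.IsWitnessSet W) {w : Plane} (hw : w ∈ W) (hreg : P.VisRegular w) {a b : Plane}
    (hab : a ≠ b) (he : segment ℝ a b ⊆ frontier (P.Vis w))
    (hfr : segment ℝ a b ∩ frontier P.region = {a, b}) :
    ∃ H, IsPreconnected H ∧ H ⊆ P.NVis W ∧ ∃ U ∈ 𝓝 (midpoint ℝ a b), P.NVis W ∩ U ⊆ H := by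
  have hK := P.isClosed_region
  have hVc : ∀ u, IsClosed (P.Vis u) := fun u => by
    rw [P.vis_eq_visibleFrom]
    exact isClosed_visibleFrom hK u
  have hxV : midpoint ℝ a b ∈ P.Vis w := (hVc w).frontier_subset (he (midpoint_mem_segment a b))
  obtain ⟨hxi, -, -, σ, hσ, hloc⟩ := window_structure hK P.locallyConic_region (hW.2.1 hw)
    (by rw [← P.vis_eq_visibleFrom]; exact hreg) hab (by rwa [← P.vis_eq_visibleFrom]) hfr
  rw [← P.vis_eq_visibleFrom] at hloc
  have hother : ∀ᶠ y in 𝓝 (midpoint ℝ a b), ∀ u ∈ W, u ≠ w → y ∉ P.Vis u := by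
    rw [hW.1.eventually_all]
    intro u hu
    by_cases huw : u = w
    · exact Filter.Eventually.of_forall fun y h => absurd huw h
    · have hxu : midpoint ℝ a b ∉ P.Vis u := fun hxu => by
        exact eq_empty_iff_forall_notMem.1 (hW.2.2 u hu w hw huw) _ ⟨hxu, hxV⟩
      filter_upwards [(hVc u).isOpen_compl.mem_nhds hxu] with y hy _
      exact hy
  obtain ⟨r, hr, hball⟩ := Metric.eventually_nhds_iff_ball.1
    ((hloc.and hother).and (mem_interior_iff_mem_nhds.1 hxi))
  refine ⟨Metric.ball (midpoint ℝ a b) r ∩ {y | σ * cross (b - a) (y - a) < 0}, ?_, ?_,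
    Metric.ball (midpoint ℝ a b) r, Metric.ball_mem_nhds _ hr, ?_⟩
  · refine ((convex_ball _ r).inter ?_).isPreconnected
    intro y hy z hz s t hs ht hst
    have hy : σ * cross (b - a) (y - a) < 0 := hy
    have hz : σ * cross (b - a) (z - a) < 0 := hz
    have e : σ * cross (b - a) (s • y + t • z - a) =
        s * (σ * cross (b - a) (y - a)) + t * (σ * cross (b - a) (z - a)) := by
      obtain rfl : s = 1 - t := by linarith
      simp only [cross, PiLp.add_apply, PiLp.sub_apply, PiLp.smul_apply, smul_eq_mul]
      ring
    change σ * cross (b - a) (s • y + t • z - a) < 0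
    rw [e]
    rcases hs.eq_or_lt with rfl | hs
    · obtain rfl : t = 1 := by linarith
      simpa using hz
    · nlinarith [mul_pos hs (neg_pos.2 hy), mul_nonneg ht (neg_pos.2 hz).le]
  · rintro y ⟨hyb, hy⟩
    have hy : σ * cross (b - a) (y - a) < 0 := hy
    obtain ⟨⟨h₁, h₂⟩, h₃⟩ := hball y hyb
    refine ⟨h₃, ?_⟩
    simp only [mem_iUnion, not_exists]
    intro u hu hyu
    by_cases huw : u = w
    · subst huw
      exact hy.not_ge (h₁.1 hyu)
    · exact h₂ u hu huw hyu
  · rintro y ⟨hyN, hyb⟩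
    refine ⟨hyb, ?_⟩
    by_contra! hy
    have hy : ¬ σ * cross (b - a) (y - a) < 0 := hy
    exact hyN.2 (mem_biUnion hw ((hball y hyb).1.1.2 (not_lt.1 hy)))

/-- Uniqueness of attached component: components attached along windows
of `Vis w` coincide iff the windows coincide. -/
theorem attached_component_unique (P : SimplePolygon) (W : Set Plane)
    (hW : P.IsWitnessSet W) (hreg : ∀ u ∈ W, P.VisRegular u)
    (w : Plane) (hw : w ∈ W)
    (NV₁ NV₂ : Set Plane) (h₁ : IsCompOf NV₁ (P.NVis W)) (h₂ : IsCompOf NV₂ (P.NVis W))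
    (e₁ e₂ : Set Plane) (he₁ : P.IsWindow w e₁) (he₂ : P.IsWindow w e₂)
    (ha₁ : e₁ ⊆ closure NV₁) (ha₂ : e₂ ⊆ closure NV₂) :
    NV₁ = NV₂ ↔ e₁ = e₂ := by
  have hK := P.isClosed_region
  have hVeq := P.vis_eq_visibleFrom w
  have hwr : P.VisRegular w := hreg w hw
  constructor
  · rintro rfl
    obtain ⟨x, hx, rfl⟩ := h₁
    obtain ⟨a, b, hab, rfl, hf₁, hfr₁, -⟩ := he₁
    obtain ⟨c, d, hcd, rfl, hf₂, hfr₂, hmax⟩ := he₂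
    have hVc : IsClosed (P.Vis w) := hVeq ▸ isClosed_visibleFrom hK w
    refine (hmax a b hab hf₁ hfr₁ fun q hq => ?_).symm
    refine mem_segment_of_mem_closure hK P.locallyConic_region P.isPreconnected_compl_region
      (hW.2.1 hw) (by rw [← hVeq]; exact hwr) hab (by rwa [← hVeq]) hfr₁
      isPreconnected_connectedComponentIn ?_ ha₁ (hVeq ▸ hVc.frontier_subset (hf₂ hq)) (ha₂ hq)
    intro y hy
    have hyN := connectedComponentIn_subset _ _ hy
    exact ⟨hyN.1, fun hyV => hyN.2 (mem_biUnion hw (hVeq ▸ hyV))⟩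
  · rintro rfl
    obtain ⟨a, b, hab, rfl, hf, hfr, -⟩ := he₁
    obtain ⟨H, hH, hHS, U, hU, hUH⟩ := P.exists_nVis_inter_subset hW hw hwr hab hf hfr
    have hx := midpoint_mem_segment (𝕜 := ℝ) a b
    obtain ⟨y, hy, hyH⟩ := (h₁.subset_of_mem_closure (ha₁ hx) hU hH hHS hUH).1
    exact h₁.eq_of_mem h₂ hy ((h₂.subset_of_mem_closure (ha₂ hx) hU hH hHS hUH).2 hyH)
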